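/- arXiv:2411.00648 — 11 statements merged into one kernel-verified Lean document; each statement's English description precedes it below -/
import Mathlib

section
/- Let F be a finite field, r ∈ F with r ≠ 0, and (m₁,m₂) ∈ F × F. Then the cardinality of the circle C((m₁,m₂), r)_F equals |F| if F has characteristic 2, equals |F| − 1 if F has characteristic different from 2 and −1 is a square in F, and equals |F| + 1 if F has characteristic different from 2 and −1 is not a square in F. -/
/-- The circle of center `(m₁, m₂)` and radius `r` over a field `F`. -/
def circleSet {F : Type*} [Field F] (M : F × F) (r : F) : Set (F × F) :=
  {P | (P.1 - M.1) ^ 2 + (P.2 - M.2) ^ 2 = r ^ 2}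

theorem circleSet_ncard_of_two_eq_zero {F : Type*} [Field F] (h2 : (2 : F) = 0)
    (m₁ m₂ r : F) : (circleSet (m₁, m₂) r).ncard = Nat.card F := by
  have hc : circleSet (m₁, m₂) r = Set.range fun t : F => (t, m₂ + r - (t - m₁)) := by
    ext ⟨x, y⟩
    simp only [circleSet, Set.mem_ofPred_eq, Set.mem_range, Prod.mk.injEq, exists_eq_left]
    constructor
    · intro h
      have h0 : ((x - m₁) + (y - m₂) - r) ^ 2 = 0 := by
        linear_combination h + ((x - m₁) * (y - m₂) - r * ((x - m₁) + (y - m₂)) + r ^ 2) * h2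
      linear_combination - (pow_eq_zero_iff two_ne_zero).mp h0
    · rintro rfl
      linear_combination ((x - m₁) ^ 2 - r * (x - m₁)) * h2
  rw [hc, ← Set.image_univ, Set.ncard_image_of_injective, Set.ncard_univ]
  intro s t hst
  exact (Prod.mk.inj hst).1

/-- Stereographic projection from the point `(m₁ - r, m₂)` of the circle. -/
theorem circleSet_ncard_eq_ncard_add_one {F : Type*} [Field F] [Finite F] (h2 : (2 : F) ≠ 0)
    (m₁ m₂ : F) {r : F} (hr : r ≠ 0) :
    (circleSet (m₁, m₂) r).ncard = {t : F | t ^ 2 = -1}ᶜ.ncard + 1 := by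
  set S : Set F := {t : F | t ^ 2 = -1}ᶜ
  have hne : ∀ {t : F}, t ∈ S → 1 + t ^ 2 ≠ 0 := fun {t} ht h =>
    ht (by simp only [Set.mem_ofPred_eq]; linear_combination h)
  let f : F → F × F := fun t =>
    (m₁ - r + 2 * r / (1 + t ^ 2), m₂ + t * (2 * r / (1 + t ^ 2)))
  have h2r : 2 * r ≠ 0 := mul_ne_zero h2 hr
  have hc : circleSet (m₁, m₂) r = insert (m₁ - r, m₂) (f '' S) := by
    ext ⟨x, y⟩
    simp only [circleSet, Set.mem_ofPred_eq, Set.mem_insert_iff, Set.mem_image, Prod.mk.injEq, f]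
    constructor
    · intro h
      by_cases hx : x - m₁ + r = 0
      · have hy : (y - m₂) ^ 2 = 0 := by linear_combination h - (x - m₁ - r) * hx
        exact Or.inl ⟨by linear_combination hx,
          by linear_combination (pow_eq_zero_iff two_ne_zero).mp hy⟩
      · have ht : 1 + ((y - m₂) / (x - m₁ + r)) ^ 2 = 2 * r / (x - m₁ + r) := by
          field_simp
          linear_combination h
        refine Or.inr ⟨(y - m₂) / (x - m₁ + r), fun h1 => ?_, ?_, ?_⟩
        · rw [Set.mem_ofPred_eq] at h1
          rw [h1, add_neg_cancel] at ht
          exact div_ne_zero h2r hx ht.symm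
        · rw [ht, div_div_cancel₀ h2r]
          ring
        · rw [ht, div_div_cancel₀ h2r, div_mul_cancel₀ _ hx]
          ring
    · rintro (⟨rfl, rfl⟩ | ⟨t, ht, rfl, rfl⟩)
      · ring
      · have := hne ht
        field_simp
        ring
  have hf : Set.InjOn f S := by
    intro s hs t ht hst
    obtain ⟨h₁, h₂⟩ := Prod.mk.inj hst
    have h₁ := add_left_cancel h₁
    have h₂ := add_left_cancel h₂
    rw [h₁] at h₂
    exact mul_right_cancel₀ (div_ne_zero h2r (hne ht)) h₂
  have hp : (m₁ - r, m₂) ∉ f '' S := by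
    rintro ⟨t, ht, h⟩
    exact div_ne_zero h2r (hne ht) (add_eq_left.mp (Prod.mk.inj h).1)
  rw [hc, Set.ncard_insert_of_notMem hp (Set.toFinite _), hf.ncard_image]

open Classical in
/-- The number of points on a circle over a finite field. -/
theorem circle_card {F : Type*} [Field F] [Fintype F] (m₁ m₂ r : F) (hr : r ≠ 0) :
    (circleSet (m₁, m₂) r).ncard =
      if ringChar F = 2 then Fintype.card F
      else if ∃ a : F, a ^ 2 = -1 then Fintype.card F - 1
      else Fintype.card F + 1 := by
  split_ifs with hF ha
  · have h2 : (2 : F) = 0 := by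
      have := ringChar.Nat.cast_ringChar (R := F)
      rw [hF] at this
      exact_mod_cast this
    rw [circleSet_ncard_of_two_eq_zero h2, Nat.card_eq_fintype_card]
  · have h2 : (2 : F) ≠ 0 := Ring.two_ne_zero hF
    obtain ⟨a, ha⟩ := ha
    have hroots : {t : F | t ^ 2 = -1} = {a, -a} := by
      ext t
      simp only [Set.mem_ofPred_eq, Set.mem_insert_iff, Set.mem_singleton_iff, ← ha,
        sq_eq_sq_iff_eq_or_eq_neg]
    have hne : a ≠ -a := by
      intro h
      have h0 : 2 * a = 0 := by linear_combination h
      have h0 := (mul_eq_zero.mp h0).resolve_left h2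
      simp [h0] at ha
    have hadd := Set.ncard_add_ncard_compl {t : F | t ^ 2 = -1}
    rw [hroots, Set.ncard_pair hne, Nat.card_eq_fintype_card] at hadd
    rw [circleSet_ncard_eq_ncard_add_one h2 m₁ m₂ hr, hroots]
    omega
  · have h2 : (2 : F) ≠ 0 := Ring.two_ne_zero hF
    have hroots : {t : F | t ^ 2 = -1} = ∅ :=
      Set.eq_empty_of_forall_notMem fun t ht => ha ⟨t, ht⟩
    rw [circleSet_ncard_eq_ncard_add_one h2 m₁ m₂ hr, hroots, Set.compl_empty, Set.ncard_univ,
      Nat.card_eq_fintype_card]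
end

section
/- Let F be a field with characteristic different from 2, let r ∈ F with r ≠ 0, (m₁,m₂) ∈ F × F, and let t₁, t₂ ∈ F with t₁² ≠ −1 and t₂² ≠ −1. Let P₁ = (m₁ + 2t₁r/(t₁²+1), m₂ + r(t₁²−1)/(t₁²+1)) and P₂ = (m₁ + 2t₂r/(t₂²+1), m₂ + r(t₂²−1)/(t₂²+1)). Then D²(P₁,P₂) = 4r²(t₁ − t₂)² / ((t₁²+1)(t₂²+1)) and D²(P₁, (m₁, m₂ + r)) = 4r² / (t₁²+1). -/
/-- Squared distance between two points of `F × F`. -/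
def sqDist {F : Type*} [Field F] (P Q : F × F) : F :=
  (P.1 - Q.1) ^ 2 + (P.2 - Q.2) ^ 2

/-- Squared distances between parametrized points on a circle
over a field of characteristic ≠ 2. -/
theorem sqDist_of_parametrized {F : Type*} [Field F] (hchar : ringChar F ≠ 2)
    (m₁ m₂ r t₁ t₂ : F) (hr : r ≠ 0) (h₁ : t₁ ^ 2 ≠ -1) (h₂ : t₂ ^ 2 ≠ -1) :
    sqDist (m₁ + 2 * t₁ * r / (t₁ ^ 2 + 1), m₂ + r * (t₁ ^ 2 - 1) / (t₁ ^ 2 + 1))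
        (m₁ + 2 * t₂ * r / (t₂ ^ 2 + 1), m₂ + r * (t₂ ^ 2 - 1) / (t₂ ^ 2 + 1))
      = 4 * r ^ 2 * (t₁ - t₂) ^ 2 / ((t₁ ^ 2 + 1) * (t₂ ^ 2 + 1)) ∧
    sqDist (m₁ + 2 * t₁ * r / (t₁ ^ 2 + 1), m₂ + r * (t₁ ^ 2 - 1) / (t₁ ^ 2 + 1))
        (m₁, m₂ + r)
      = 4 * r ^ 2 / (t₁ ^ 2 + 1) := by
  have h₁' : t₁ ^ 2 + 1 ≠ 0 := fun h => h₁ (eq_neg_of_add_eq_zero_left h)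
  have h₂' : t₂ ^ 2 + 1 ≠ 0 := fun h => h₂ (eq_neg_of_add_eq_zero_left h)
  constructor <;> simp only [sqDist] <;> field_simp <;> ring
end

section
/- Let F be a field with characteristic different from 2, let r ∈ F with r ≠ 0, M ∈ F × F, and let P, Q be two distinct points of the circle C(M,r)_F. Then D²(P,Q) ≠ 0. -/
/-- In characteristic ≠ 2, squared distances between distinct points of a circle
do not vanish. -/
theorem sqDist_ne_zero_of_char_ne_two {F : Type*} [Field F] (hchar : ringChar F ≠ 2)
    (M : F × F) (r : F) (hr : r ≠ 0) (P Q : F × F)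
    (hP : P ∈ circleSet M r) (hQ : Q ∈ circleSet M r) (hPQ : P ≠ Q) :
    sqDist P Q ≠ 0 := by
  intro hD
  obtain ⟨m, n⟩ := M
  obtain ⟨p, q⟩ := P
  obtain ⟨s, t⟩ := Q
  simp only [circleSet, sqDist, Set.mem_ofPred_eq] at hP hQ hD
  have hr2 : r ^ 2 ≠ 0 := pow_ne_zero 2 hr
  have hdot : (p - m) * (s - m) + (q - n) * (t - n) = r ^ 2 :=
    mul_left_cancel₀ (Ring.two_ne_zero hchar) (by linear_combination hP + hQ - hD)
  have hcross : (p - m) * (t - n) - (q - n) * (s - m) = 0 := by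
    refine pow_eq_zero_iff two_ne_zero |>.mp ?_
    linear_combination ((s - m) ^ 2 + (t - n) ^ 2) * hP + r ^ 2 * hQ
      - ((p - m) * (s - m) + (q - n) * (t - n) + r ^ 2) * hdot
  refine hPQ (Prod.ext (mul_left_cancel₀ hr2 ?_) (mul_left_cancel₀ hr2 ?_))
  · linear_combination (s - m) * hP - (p - m) * hdot + (q - n) * hcross
  · linear_combination (t - n) * hP - (q - n) * hdot - (p - m) * hcross
end

section
/- Let (m₁,m₂) ∈ ℚ × ℚ and r ∈ ℚ with r ≠ 0. Then the set of points P on the circle C((m₁,m₂), r)_ℚ such that D²(P, (m₁, m₂ + r)) is the square of a rational number is infinite. -/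
/-- The map `t ↦ 2t / (1 + t²)` is injective on rationals greater than one. -/
lemma two_mul_div_one_add_sq_injOn :
    Set.InjOn (fun t : ℚ => 2 * t / (1 + t ^ 2)) (Set.Ioi 1) := by
  intro t ht u hu h
  have ht' : (1 : ℚ) < t := ht
  have hu' : (1 : ℚ) < u := hu
  have h' : 2 * t / (1 + t ^ 2) = 2 * u / (1 + u ^ 2) := h
  rw [div_eq_div_iff (by positivity) (by positivity)] at h'
  have hprod : (t - u) * (1 - t * u) = 0 := by linear_combination h' / 2
  rcases mul_eq_zero.mp hprod with h0 | h0
  · linarith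
  · nlinarith

/-- On any circle over `ℚ`, infinitely many points have rational squared distance
to the top point `(m₁, m₂ + r)`. -/
theorem infinitely_many_points_rational_dist_to_top (m₁ m₂ r : ℚ) (hr : r ≠ 0) :
    {P : ℚ × ℚ | (P.1 - m₁) ^ 2 + (P.2 - m₂) ^ 2 = r ^ 2 ∧
      ∃ a : ℚ, (P.1 - m₁) ^ 2 + (P.2 - (m₂ + r)) ^ 2 = a ^ 2}.Infinite := by
  let s : ℚ → ℚ := fun t => 2 * t / (1 + t ^ 2)
  let c : ℚ → ℚ := fun t => (1 - t ^ 2) / (1 + t ^ 2)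
  have hsc (t : ℚ) : s t ^ 2 + c t ^ 2 = 1 := by
    have : 1 + t ^ 2 ≠ 0 := by positivity
    simp only [s, c]
    field_simp
    ring
  refine Set.infinite_of_injOn_mapsTo (s := Set.Ioi (1 : ℚ))
    (f := fun t => (m₁ + 2 * r * s t * c t, m₂ + r * (1 - 2 * s t ^ 2))) ?_ ?_
    (Set.Ioi_infinite 1)
  · intro t ht u hu h
    have ht0 : (0 : ℚ) < t := zero_lt_one.trans ht
    have hu0 : (0 : ℚ) < u := zero_lt_one.trans hu
    have hy : m₂ + r * (1 - 2 * s t ^ 2) = m₂ + r * (1 - 2 * s u ^ 2) :=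
      congrArg Prod.snd h
    have hsq : s t ^ 2 = s u ^ 2 := by
      apply mul_left_cancel₀ hr
      linear_combination -hy / 2
    have hst : 0 ≤ s t := by simp only [s]; positivity
    have hsu : 0 ≤ s u := by simp only [s]; positivity
    exact two_mul_div_one_add_sq_injOn ht hu ((sq_eq_sq₀ hst hsu).mp hsq)
  · intro t _
    refine ⟨?_, 2 * r * s t, ?_⟩
    · linear_combination 4 * r ^ 2 * s t ^ 2 * hsc t
    · linear_combination 4 * r ^ 2 * s t ^ 2 * hsc t
end

section
/- Let F be a field with characteristic different from 2, M ∈ F × F, r ∈ F with r ≠ 0, and let q be a perfect distance with respect to the circle C(M,r)_F. Then q = a² for some a in the prime subfield of F, and 1 − q/(4r²) = b² for some b in the prime subfield of F. -/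
/-- A squared distance is rational if it is the square of an element of the
prime subfield. -/
def IsRationalSqDist {F : Type*} [Field F] (q : F) : Prop :=
  ∃ a ∈ (⊥ : Subfield F), q = a ^ 2

/-- A squared distance `q` is perfect with respect to a circle if there are three
pairwise distinct points on the circle with all pairwise squared distances rational,
one of them equal to `q`. -/
def IsPerfectDist {F : Type*} [Field F] (M : F × F) (r : F) (q : F) : Prop :=
  ∃ P₁ P₂ P₃ : F × F, P₁ ∈ circleSet M r ∧ P₂ ∈ circleSet M r ∧ P₃ ∈ circleSet M r ∧
    P₁ ≠ P₂ ∧ P₁ ≠ P₃ ∧ P₂ ≠ P₃ ∧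
    IsRationalSqDist (sqDist P₁ P₂) ∧ IsRationalSqDist (sqDist P₁ P₃) ∧
    IsRationalSqDist (sqDist P₂ P₃) ∧ sqDist P₁ P₂ = q

/-- Distinct points of a circle of nonzero radius are not joined by an isotropic vector. -/
theorem sqDist_ne_zero_of_mem_circleSet {F : Type*} [Field F] (h2 : (2 : F) ≠ 0)
    {M : F × F} {r : F} (hr : r ≠ 0) {P Q : F × F} (hP : P ∈ circleSet M r)
    (hQ : Q ∈ circleSet M r) (hPQ : P ≠ Q) : sqDist P Q ≠ 0 := by
  obtain ⟨p₁, p₂⟩ := P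
  obtain ⟨q₁, q₂⟩ := Q
  obtain ⟨m₁, m₂⟩ := M
  simp only [circleSet, Set.mem_ofPred_eq, sqDist] at *
  intro h
  have hdot : (p₁ - q₁) * (m₁ - q₁) + (p₂ - q₂) * (m₂ - q₂) = 0 :=
    mul_left_cancel₀ h2 (by linear_combination h - hP + hQ)
  have hcross : (p₁ - q₁) * (m₂ - q₂) - (p₂ - q₂) * (m₁ - q₁) = 0 := by
    refine pow_eq_zero_iff two_ne_zero |>.mp ?_
    linear_combination ((m₁ - q₁) ^ 2 + (m₂ - q₂) ^ 2) * h -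
      ((p₁ - q₁) * (m₁ - q₁) + (p₂ - q₂) * (m₂ - q₂)) * hdot
  have hr2 : r ^ 2 ≠ 0 := pow_ne_zero 2 hr
  apply hPQ
  have h₁ : p₁ - q₁ = 0 := mul_left_cancel₀ hr2 (by
    linear_combination (m₁ - q₁) * hdot + (m₂ - q₂) * hcross - (p₁ - q₁) * hQ)
  have h₂ : p₂ - q₂ = 0 := mul_left_cancel₀ hr2 (by
    linear_combination (m₂ - q₂) * hdot - (m₁ - q₁) * hcross - (p₂ - q₂) * hQ)
  rw [sub_eq_zero.mp h₁, sub_eq_zero.mp h₂]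

/-- The circumradius formula `r² (4 |u|² |v|² - (2 u ⬝ v)²) = |u|² |v|² |u - v|²`. -/
theorem circumradius_sq_mul {F : Type*} [Field F]
    {M : F × F} {r : F} {P Q R : F × F} (hP : P ∈ circleSet M r)
    (hQ : Q ∈ circleSet M r) (hR : R ∈ circleSet M r) :
    r ^ 2 * (4 * sqDist P R * sqDist Q R - (sqDist P R + sqDist Q R - sqDist P Q) ^ 2) =
      sqDist P R * sqDist Q R * sqDist P Q := by
  obtain ⟨p₁, p₂⟩ := P
  obtain ⟨q₁, q₂⟩ := Q
  obtain ⟨s₁, s₂⟩ := R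
  obtain ⟨m₁, m₂⟩ := M
  simp only [circleSet, Set.mem_ofPred_eq, sqDist] at *
  obtain ⟨u₁, rfl⟩ : ∃ u, p₁ = s₁ + u := ⟨p₁ - s₁, by ring⟩
  obtain ⟨u₂, rfl⟩ : ∃ u, p₂ = s₂ + u := ⟨p₂ - s₂, by ring⟩
  obtain ⟨v₁, rfl⟩ : ∃ v, q₁ = s₁ + v := ⟨q₁ - s₁, by ring⟩
  obtain ⟨v₂, rfl⟩ : ∃ v, q₂ = s₂ + v := ⟨q₂ - s₂, by ring⟩
  obtain ⟨w₁, rfl⟩ : ∃ w, m₁ = s₁ + w := ⟨m₁ - s₁, by ring⟩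
  obtain ⟨w₂, rfl⟩ : ∃ w, m₂ = s₂ + w := ⟨m₂ - s₂, by ring⟩
  have hu : u₁ ^ 2 + u₂ ^ 2 = 2 * (u₁ * w₁ + u₂ * w₂) := by linear_combination hP - hR
  have hv : v₁ ^ 2 + v₂ ^ 2 = 2 * (v₁ * w₁ + v₂ * w₂) := by linear_combination hQ - hR
  have hw : r ^ 2 = w₁ ^ 2 + w₂ ^ 2 := by linear_combination -hR
  have hx : 2 * w₁ * (u₁ * v₂ - u₂ * v₁) =
      (u₁ ^ 2 + u₂ ^ 2) * v₂ - (v₁ ^ 2 + v₂ ^ 2) * u₂ := by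
    linear_combination u₂ * hv - v₂ * hu
  have hy : 2 * w₂ * (u₁ * v₂ - u₂ * v₁) =
      (v₁ ^ 2 + v₂ ^ 2) * u₁ - (u₁ ^ 2 + u₂ ^ 2) * v₁ := by
    linear_combination v₁ * hu - u₁ * hv
  rw [hw]
  linear_combination
    (2 * w₁ * (u₁ * v₂ - u₂ * v₁) + (u₁ ^ 2 + u₂ ^ 2) * v₂ - (v₁ ^ 2 + v₂ ^ 2) * u₂) * hx +
    (2 * w₂ * (u₁ * v₂ - u₂ * v₁) + (v₁ ^ 2 + v₂ ^ 2) * u₁ - (u₁ ^ 2 + u₂ ^ 2) * v₁) * hy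

/-- A perfect distance satisfies the algebraic circle property. -/
theorem perfect_dist_algebraic_circle_property {F : Type*} [Field F]
    (hchar : ringChar F ≠ 2) (M : F × F) (r : F) (hr : r ≠ 0) (q : F)
    (hq : IsPerfectDist M r q) :
    (∃ a ∈ (⊥ : Subfield F), q = a ^ 2) ∧
    (∃ b ∈ (⊥ : Subfield F), 1 - q / (4 * r ^ 2) = b ^ 2) := by
  have h2 : (2 : F) ≠ 0 := Ring.two_ne_zero hchar
  obtain ⟨P₁, P₂, P₃, h₁, h₂, h₃, -, h₁₃, h₂₃, ⟨c, hc, hc'⟩, ⟨b, hb, hb'⟩, ⟨a, ha, ha'⟩, rfl⟩ := hq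
  refine ⟨⟨c, hc, hc'⟩, (b ^ 2 + a ^ 2 - c ^ 2) / (2 * a * b), ?_, ?_⟩
  · have h2mem : (2 : F) ∈ (⊥ : Subfield F) := ofNat_mem _ 2
    exact div_mem (sub_mem (add_mem (pow_mem hb 2) (pow_mem ha 2)) (pow_mem hc 2))
      (mul_mem (mul_mem h2mem ha) hb)
  · have hb0 := sqDist_ne_zero_of_mem_circleSet h2 hr h₁ h₃ h₁₃
    have ha0 := sqDist_ne_zero_of_mem_circleSet h2 hr h₂ h₃ h₂₃
    have hcirc := circumradius_sq_mul h₁ h₂ h₃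
    rw [ha', hb', hc'] at hcirc
    rw [hb', pow_ne_zero_iff two_ne_zero] at hb0
    rw [ha', pow_ne_zero_iff two_ne_zero] at ha0
    have h4 : (4 : F) ≠ 0 := by
      rw [show (4 : F) = 2 * 2 by norm_num]
      exact mul_ne_zero h2 h2
    have hr4 : 4 * r ^ 2 ≠ 0 := mul_ne_zero h4 (pow_ne_zero 2 hr)
    have hab : (2 * a * b) ^ 2 ≠ 0 := pow_ne_zero 2 (mul_ne_zero (mul_ne_zero h2 ha0) hb0)
    rw [hc', div_pow, one_sub_div hr4, div_eq_div_iff hr4 hab]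
    linear_combination 4 * hcirc
end

section
/- Let F be a field with characteristic different from 2, r ∈ F with r ≠ 0, and let S be a subset of the circle C((0,0), r)_F of cardinality at least 3 such that for all P, Q ∈ S the squared distance D²(P,Q) equals a² for some a in the prime subfield of F. Let q ∈ F with q ≠ 0 be such that q = a² and 1 − q/(4r²) = b² for some a, b in the prime subfield of F. Then for every P ∈ S, every point Q on C((0,0), r)_F with D²(P,Q) = q, and every R ∈ S, the squared distance D²(Q,R) equals c² for some c in the prime subfield of F. -/
/-- Two points of a circle at squared distance zero coincide. -/
lemma eq_of_sqDist_eq_zero {F : Type*} [Field F] (h2 : (2 : F) ≠ 0) {r : F} (hr : r ≠ 0)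
    {P Q : F × F} (hP : P ∈ circleSet ((0 : F), (0 : F)) r)
    (hQ : Q ∈ circleSet ((0 : F), (0 : F)) r) (h : sqDist P Q = 0) : P = Q := by
  obtain ⟨x, y⟩ := P
  obtain ⟨u, v⟩ := Q
  simp only [circleSet, sqDist, Set.mem_ofPred_eq, sub_zero] at hP hQ h
  have hdot : x * u + y * v = r ^ 2 := by
    apply mul_left_cancel₀ h2
    linear_combination hP + hQ - h
  have hcross : x * v - y * u = 0 := by
    apply pow_eq_zero_iff two_ne_zero |>.mp
    linear_combination (u ^ 2 + v ^ 2) * hP + r ^ 2 * hQ - (x * u + y * v + r ^ 2) * hdot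
  have hr2 : r ^ 2 ≠ 0 := pow_ne_zero 2 hr
  ext
  · apply mul_left_cancel₀ hr2
    linear_combination -x * hQ + u * hdot + v * hcross
  · apply mul_left_cancel₀ hr2
    linear_combination -y * hQ + v * hdot - u * hcross

/-- The law of cosines combined with the inscribed angle theorem, without denominators. -/
lemma sqDist_inscribed {F : Type*} [Field F] {r : F} {P R T : F × F}
    (hP : P ∈ circleSet ((0 : F), (0 : F)) r) (hR : R ∈ circleSet ((0 : F), (0 : F)) r)
    (hT : T ∈ circleSet ((0 : F), (0 : F)) r) :
    4 * sqDist P T * sqDist R T * (4 * r ^ 2 - sqDist P R) =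
      4 * r ^ 2 * (sqDist P T + sqDist R T - sqDist P R) ^ 2 := by
  have key : ∀ A ∈ circleSet ((0 : F), (0 : F)) r, ∀ B ∈ circleSet ((0 : F), (0 : F)) r,
      sqDist A B = 2 * r ^ 2 - 2 * (A.1 * B.1 + A.2 * B.2) := by
    intro A hA B hB
    simp only [circleSet, sqDist, Set.mem_ofPred_eq, sub_zero] at hA hB ⊢
    linear_combination hA + hB
  rw [key P hP T hT, key R hR T hT, key P hP R hR]
  simp only [circleSet, Set.mem_ofPred_eq, sub_zero] at hP hR hT
  have gram : ∀ a b c p m n : F, a = P.1 ^ 2 + P.2 ^ 2 → b = R.1 ^ 2 + R.2 ^ 2 →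
      c = T.1 ^ 2 + T.2 ^ 2 → p = P.1 * R.1 + P.2 * R.2 → m = P.1 * T.1 + P.2 * T.2 →
      n = R.1 * T.1 + R.2 * T.2 →
      a * b * c + 2 * p * m * n - a * n ^ 2 - b * m ^ 2 - c * p ^ 2 = 0 := by
    rintro a b c p m n rfl rfl rfl rfl rfl rfl
    ring
  linear_combination 16 * gram _ _ _ _ _ _ hP.symm hR.symm hT.symm rfl rfl rfl

/-- The addition formula for half angles: if `1 - D²/(4r²)` is a square for the chords `PQ` and
`PR` of lengths `a` and `d`, then the chord `QR` is `a g ± b d`. -/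
lemma sqDist_eq_sq_or {F : Type*} [Field F] (h2 : (2 : F) ≠ 0) {r : F} (hr : r ≠ 0)
    {P Q R : F × F} (hP : P ∈ circleSet ((0 : F), (0 : F)) r)
    (hQ : Q ∈ circleSet ((0 : F), (0 : F)) r) (hR : R ∈ circleSet ((0 : F), (0 : F)) r)
    {a b d g : F} (ha : sqDist P Q = a ^ 2) (hb : 4 * r ^ 2 - a ^ 2 = 4 * r ^ 2 * b ^ 2)
    (hd : sqDist P R = d ^ 2) (hg : 4 * r ^ 2 - d ^ 2 = 4 * r ^ 2 * g ^ 2) :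
    sqDist Q R = (a * g - b * d) ^ 2 ∨ sqDist Q R = (a * g + b * d) ^ 2 := by
  obtain ⟨x, y⟩ := P
  obtain ⟨u, v⟩ := Q
  obtain ⟨z, w⟩ := R
  simp only [circleSet, sqDist, Set.mem_ofPred_eq, sub_zero] at *
  have h4 : (4 : F) ≠ 0 := by
    rw [show (4 : F) = 2 * 2 by norm_num]
    exact mul_ne_zero h2 h2
  have dot : ∀ s t e : F, s ^ 2 + t ^ 2 = r ^ 2 → (x - s) ^ 2 + (y - t) ^ 2 = e ^ 2 →
      2 * (x * s + y * t) = 2 * r ^ 2 - e ^ 2 := by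
    intro s t e hs he
    linear_combination hP + hs - he
  have cross : ∀ s t e f : F, s ^ 2 + t ^ 2 = r ^ 2 → (x - s) ^ 2 + (y - t) ^ 2 = e ^ 2 →
      4 * r ^ 2 - e ^ 2 = 4 * r ^ 2 * f ^ 2 → (x * t - y * s) ^ 2 = (r * e * f) ^ 2 := by
    intro s t e f hs he hf
    apply mul_left_cancel₀ h4
    linear_combination 4 * (s ^ 2 + t ^ 2) * hP + 4 * r ^ 2 * hs + e ^ 2 * hf
      - (2 * (x * s + y * t) + (2 * r ^ 2 - e ^ 2)) * dot s t e hs he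
  have hprod : ((x * v - y * u) * (x * w - y * z)) ^ 2 = (r ^ 2 * (a * b * d * g)) ^ 2 := by
    rw [mul_pow, cross u v a b hQ ha hb, cross z w d g hR hd hg]
    ring
  have hQR : (2 * r ^ 2) * ((u - z) ^ 2 + (v - w) ^ 2) = 4 * r ^ 4
      - (2 * r ^ 2 - a ^ 2) * (2 * r ^ 2 - d ^ 2)
      - 4 * ((x * v - y * u) * (x * w - y * z)) := by
    rw [← dot u v a hQ ha, ← dot z w d hR hd]
    linear_combination 2 * r ^ 2 * hQ + 2 * r ^ 2 * hR + 4 * (u * z + v * w) * hP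
  have h2r : (2 * r ^ 2 : F) ≠ 0 := mul_ne_zero h2 (pow_ne_zero 2 hr)
  rcases sq_eq_sq_iff_eq_or_eq_neg.mp hprod with h | h
  · left
    apply mul_left_cancel₀ h2r
    apply mul_left_cancel₀ h2
    linear_combination 2 * hQR - 8 * h + a ^ 2 * hg + d ^ 2 * hb
  · right
    apply mul_left_cancel₀ h2r
    apply mul_left_cancel₀ h2
    linear_combination 2 * hQR - 8 * h + a ^ 2 * hg + d ^ 2 * hb

/-- Extension property: a nonzero rational squared distance `q` with
`1 - q/(4r²)` a square in the prime subfield propagates rationality of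
distances to a circular point set of cardinality at least three. -/
theorem extension_property {F : Type*} [Field F] (hchar : ringChar F ≠ 2)
    (r : F) (hr : r ≠ 0) (S : Set (F × F)) (hS : S ⊆ circleSet ((0 : F), (0 : F)) r)
    (hcard : 3 ≤ S.encard)
    (hrat : ∀ P ∈ S, ∀ Q ∈ S, ∃ a ∈ (⊥ : Subfield F), sqDist P Q = a ^ 2)
    (q : F) (hq0 : q ≠ 0)
    (hq1 : ∃ a ∈ (⊥ : Subfield F), q = a ^ 2)
    (hq2 : ∃ b ∈ (⊥ : Subfield F), 1 - q / (4 * r ^ 2) = b ^ 2) :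
    ∀ P ∈ S, ∀ Q ∈ circleSet ((0 : F), (0 : F)) r, sqDist P Q = q →
      ∀ R ∈ S, ∃ c ∈ (⊥ : Subfield F), sqDist Q R = c ^ 2 := by
  intro P hP Q hQ hPQ R hR
  have h2 : (2 : F) ≠ 0 := Ring.two_ne_zero hchar
  have h4 : (4 : F) ≠ 0 := by
    rw [show (4 : F) = 2 * 2 by norm_num]
    exact mul_ne_zero h2 h2
  have h4r : (4 * r ^ 2 : F) ≠ 0 := mul_ne_zero h4 (pow_ne_zero 2 hr)
  obtain ⟨a, ha, rfl⟩ := hq1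
  obtain ⟨b, hb, hab⟩ := hq2
  by_cases hPR : P = R
  · subst hPR
    exact ⟨a, ha, by rw [← hPQ]; simp only [sqDist]; ring⟩
  obtain ⟨T, hT, hTPR⟩ : ∃ T ∈ S, T ∉ ({P, R} : Set (F × F)) := by
    by_contra! hsub
    have h := hcard.trans ((Set.encard_le_encard hsub).trans_eq (Set.encard_pair hPR))
    exact absurd h (by norm_num)
  simp only [Set.mem_insert_iff, Set.mem_singleton_iff, not_or] at hTPR
  obtain ⟨d, hd, hd'⟩ := hrat P hP R hR
  obtain ⟨e, he, he'⟩ := hrat P hP T hT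
  obtain ⟨f, hf, hf'⟩ := hrat R hR T hT
  have he0 : e ≠ 0 := by
    rintro rfl
    exact hTPR.1 (eq_of_sqDist_eq_zero h2 hr (hS hP) (hS hT) (by simpa using he')).symm
  have hf0 : f ≠ 0 := by
    rintro rfl
    exact hTPR.2 (eq_of_sqDist_eq_zero h2 hr (hS hR) (hS hT) (by simpa using hf')).symm
  have h2k : (2 : F) ∈ (⊥ : Subfield F) := ofNat_mem _ 2
  have hg : (e ^ 2 + f ^ 2 - d ^ 2) / (2 * e * f) ∈ (⊥ : Subfield F) :=
    div_mem (sub_mem (add_mem (pow_mem he 2) (pow_mem hf 2)) (pow_mem hd 2))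
      (mul_mem (mul_mem h2k he) hf)
  have hdg : 4 * r ^ 2 - d ^ 2 = 4 * r ^ 2 * ((e ^ 2 + f ^ 2 - d ^ 2) / (2 * e * f)) ^ 2 := by
    have h := sqDist_inscribed (hS hP) (hS hR) (hS hT)
    rw [hd', he', hf'] at h
    rw [div_pow, ← mul_div_assoc, eq_div_iff (pow_ne_zero 2 (mul_ne_zero (mul_ne_zero h2 he0) hf0))]
    linear_combination h
  have hab' : 4 * r ^ 2 - a ^ 2 = 4 * r ^ 2 * b ^ 2 := by
    rw [← hab, mul_sub, mul_div_cancel₀ _ h4r, mul_one]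
  rcases sqDist_eq_sq_or h2 hr (hS hP) hQ (hS hR) hPQ hab' hd' hdg with h | h
  · exact ⟨_, sub_mem (mul_mem ha hg) (mul_mem hb hd), h⟩
  · exact ⟨_, add_mem (mul_mem ha hg) (mul_mem hb hd), h⟩
end

section
/- Let F be a prime field (a field equal to its own prime subfield) of characteristic different from 2, let M ∈ F × F, r ∈ F with r ≠ 0, and let q ∈ F be a nonzero square in F with q ≠ 4r². If there exist two points P₁, P₂ on the circle C(M,r)_F with D²(P₁,P₂) = q, then q is perfect with respect to C(M,r)_F; that is, there exist three pairwise distinct points on C(M,r)_F all of whose pairwise squared distances are squares in F and one of these squared distances equals q. -/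
/-- Reflecting a point `v` of the circle of radius `r` about the origin in the line spanned by
a point `u` of that circle: the image lies on the circle, is as far from `u` as `v` is, and its
squared distance to `v` is a square. -/
theorem reflection_on_circle {F : Type*} [Field F] {r a b c d : F} (hr : r ≠ 0)
    (hu : a ^ 2 + b ^ 2 = r ^ 2) (hv : c ^ 2 + d ^ 2 = r ^ 2) :
    ∃ e f : F, e ^ 2 + f ^ 2 = r ^ 2 ∧
      (a - e) ^ 2 + (b - f) ^ 2 = (a - c) ^ 2 + (b - d) ^ 2 ∧
      (c - e) ^ 2 + (d - f) ^ 2 = (2 * (a * d - b * c) / r) ^ 2 := by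
  obtain ⟨k, hk⟩ : ∃ k : F, k * r ^ 2 = a * c + b * d :=
    ⟨(a * c + b * d) / r ^ 2, by field_simp⟩
  refine ⟨2 * k * a - c, 2 * k * b - d, ?_, ?_, ?_⟩
  · linear_combination 4 * k ^ 2 * hu + hv + 4 * k * hk
  · linear_combination (4 * k ^ 2 - 4 * k) * hu + (4 * k - 4) * hk
  · rw [div_pow, eq_div_iff (pow_ne_zero 2 hr)]
    linear_combination (4 * k ^ 2 * r ^ 2 - 4 * (c ^ 2 + d ^ 2)) * hu +
      4 * (k * r ^ 2 - (a * c + b * d)) * hk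

/-- Over a prime field, every nonzero square `q ≠ 4r²` occurring as a squared
distance between two points of a circle is perfect. -/
theorem occurring_square_dist_is_perfect {F : Type*} [Field F]
    (hprime : (⊥ : Subfield F) = ⊤) (hchar : ringChar F ≠ 2)
    (M : F × F) (r : F) (hr : r ≠ 0) (q : F) (hq0 : q ≠ 0)
    (hqsq : ∃ a : F, q = a ^ 2) (hq4 : q ≠ 4 * r ^ 2)
    (P₁ P₂ : F × F) (hP₁ : P₁ ∈ circleSet M r) (hP₂ : P₂ ∈ circleSet M r)
    (hdist : sqDist P₁ P₂ = q) :
    ∃ Q₁ Q₂ Q₃ : F × F, Q₁ ∈ circleSet M r ∧ Q₂ ∈ circleSet M r ∧ Q₃ ∈ circleSet M r ∧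
      Q₁ ≠ Q₂ ∧ Q₁ ≠ Q₃ ∧ Q₂ ≠ Q₃ ∧
      (∃ a : F, sqDist Q₁ Q₂ = a ^ 2) ∧ (∃ a : F, sqDist Q₁ Q₃ = a ^ 2) ∧
      (∃ a : F, sqDist Q₂ Q₃ = a ^ 2) ∧ sqDist Q₁ Q₂ = q := by
  obtain ⟨m, n⟩ := M
  obtain ⟨a, b⟩ := P₁
  obtain ⟨c, d⟩ := P₂
  simp only [circleSet, Set.mem_ofPred_eq, sqDist] at hP₁ hP₂ hdist ⊢
  have two_ne : (2 : F) ≠ 0 := Ring.two_ne_zero hchar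
  obtain ⟨e, f, hQ, h13, h23⟩ := reflection_on_circle hr hP₁ hP₂
  refine ⟨(a, b), (c, d), (m + e, n + f), hP₁, hP₂, ?_, ?_, ?_, ?_, hdist ▸ hqsq, ?_, ?_, hdist⟩
  · linear_combination hQ
  · rintro ⟨⟩
    exact hq0 (by linear_combination -hdist)
  · intro h
    obtain ⟨h1, h2⟩ := Prod.mk.inj h
    refine hq0 ?_
    linear_combination (-1) * hdist - h13 + (a - m - e) * h1 + (b - n - f) * h2
  · intro h
    obtain ⟨h1, h2⟩ := Prod.mk.inj h
    have hcross : (a - m) * (d - n) - (b - n) * (c - m) = 0 := by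
      have h0 : (2 * ((a - m) * (d - n) - (b - n) * (c - m)) / r) ^ 2 = 0 := by
        linear_combination (-1) * h23 + (c - m - e) * h1 + (d - n - f) * h2
      simpa [two_ne, hr] using h0
    have hprod : q * (q - 4 * r ^ 2) = 0 := by
      have hdot : q = 2 * r ^ 2 - 2 * ((a - m) * (c - m) + (b - n) * (d - n)) := by
        linear_combination (-1) * hdist + hP₁ + hP₂
      rw [hdot]
      linear_combination 4 * ((c - m) ^ 2 + (d - n) ^ 2) * hP₁ + 4 * r ^ 2 * hP₂ -
        4 * ((a - m) * (d - n) - (b - n) * (c - m)) * hcross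
    rcases mul_eq_zero.mp hprod with h | h
    · exact hq0 h
    · exact hq4 (sub_eq_zero.mp h)
  · obtain ⟨t, ht⟩ := hqsq
    exact ⟨t, by linear_combination h13 + hdist + ht⟩
  · refine ⟨2 * ((a - m) * (d - n) - (b - n) * (c - m)) / r, ?_⟩
    linear_combination h23
end

section
/- Let F be a field with characteristic different from 2, M ∈ F × F, r ∈ F with r ≠ 0, let P be a point of the circle C(M,r)_F, and let q be a perfect distance with respect to C(M,r)_F. Then there exists a point Q on C(M,r)_F with D²(P,Q) = q. Moreover, there exist two distinct points Q₁ ≠ Q₂ on C(M,r)_F with D²(P,Q₁) = D²(P,Q₂) = q if and only if q ≠ 4r². -/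
/-- Two points of a circle whose position vectors from the center have inner product `c * r ^ 2`
with `c ^ 2 = 1` satisfy `Q - M = c • (P - M)`. -/
lemma eq_of_inner_eq_of_mem_circleSet {F : Type*} [Field F] {M P Q : F × F} {r c : F}
    (hr : r ≠ 0) (hP : P ∈ circleSet M r) (hQ : Q ∈ circleSet M r) (hc : c ^ 2 = 1)
    (h : (P.1 - M.1) * (Q.1 - M.1) + (P.2 - M.2) * (Q.2 - M.2) = c * r ^ 2) :
    Q = (M.1 + c * (P.1 - M.1), M.2 + c * (P.2 - M.2)) := by
  simp only [circleSet, Set.mem_ofPred_eq] at hP hQ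
  have hcross : (P.1 - M.1) * (Q.2 - M.2) - (P.2 - M.2) * (Q.1 - M.1) = 0 := by
    refine pow_eq_zero_iff two_ne_zero |>.mp ?_
    linear_combination ((Q.1 - M.1) ^ 2 + (Q.2 - M.2) ^ 2) * hP + r ^ 2 * hQ - r ^ 4 * hc -
      ((P.1 - M.1) * (Q.1 - M.1) + (P.2 - M.2) * (Q.2 - M.2) + c * r ^ 2) * h
  have hr2 : r ^ 2 ≠ 0 := pow_ne_zero 2 hr
  refine Prod.ext (mul_left_cancel₀ hr2 ?_) (mul_left_cancel₀ hr2 ?_)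
  · linear_combination -(Q.1 - M.1) * hP + (P.1 - M.1) * h - (P.2 - M.2) * hcross
  · linear_combination -(Q.2 - M.2) * hP + (P.2 - M.2) * h + (P.1 - M.1) * hcross

/-- The squared distance between two distinct points of a circle comes from a nontrivial
rotation `(a, b)`. -/
lemma exists_rotation_of_mem_circleSet {F : Type*} [Field F] {M P Q : F × F} {r : F}
    (hr : r ≠ 0) (hP : P ∈ circleSet M r) (hQ : Q ∈ circleSet M r) (hPQ : P ≠ Q) :
    ∃ a b : F, a ^ 2 + b ^ 2 = 1 ∧ a ≠ 1 ∧ sqDist P Q = r ^ 2 * (2 - 2 * a) := by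
  have hP' := hP
  have hQ' := hQ
  simp only [circleSet, Set.mem_ofPred_eq] at hP' hQ'
  refine ⟨((P.1 - M.1) * (Q.1 - M.1) + (P.2 - M.2) * (Q.2 - M.2)) / r ^ 2,
    ((P.1 - M.1) * (Q.2 - M.2) - (P.2 - M.2) * (Q.1 - M.1)) / r ^ 2, ?_, ?_, ?_⟩
  · field_simp
    linear_combination ((Q.1 - M.1) ^ 2 + (Q.2 - M.2) ^ 2) * hP' + r ^ 2 * hQ'
  · intro h
    rw [div_eq_one_iff_eq (pow_ne_zero 2 hr)] at h
    have hQP := eq_of_inner_eq_of_mem_circleSet (c := 1) hr hP hQ (one_pow 2) (by rw [h, one_mul])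
    apply hPQ
    rw [hQP]
    simp
  · unfold sqDist
    field_simp
    linear_combination hP' + hQ'

/-- Rotating a point of a circle by `(a, b)` gives a point of the circle at squared distance
`r ^ 2 * (2 - 2 * a)`. -/
lemma rotation_mem_circleSet {F : Type*} [Field F] {M P : F × F} {r a b : F}
    (hP : P ∈ circleSet M r) (hab : a ^ 2 + b ^ 2 = 1) :
    (M.1 + a * (P.1 - M.1) - b * (P.2 - M.2), M.2 + b * (P.1 - M.1) + a * (P.2 - M.2)) ∈
        circleSet M r ∧
      sqDist P (M.1 + a * (P.1 - M.1) - b * (P.2 - M.2),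
        M.2 + b * (P.1 - M.1) + a * (P.2 - M.2)) = r ^ 2 * (2 - 2 * a) := by
  simp only [circleSet, Set.mem_ofPred_eq, sqDist] at hP ⊢
  constructor
  · linear_combination hP + ((P.1 - M.1) ^ 2 + (P.2 - M.2) ^ 2) * hab
  · linear_combination (2 - 2 * a) * hP + ((P.1 - M.1) ^ 2 + (P.2 - M.2) ^ 2) * hab

/-- Over a field of characteristic different from two, the only point of a circle at squared
distance `4 * r ^ 2` from `P` is the antipode of `P`. -/
lemma eq_antipode_of_sqDist_eq {F : Type*} [Field F] (h2 : (2 : F) ≠ 0) {M P Q : F × F} {r : F}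
    (hr : r ≠ 0) (hP : P ∈ circleSet M r) (hQ : Q ∈ circleSet M r)
    (h : sqDist P Q = 4 * r ^ 2) :
    Q = (M.1 + -1 * (P.1 - M.1), M.2 + -1 * (P.2 - M.2)) := by
  refine eq_of_inner_eq_of_mem_circleSet hr hP hQ (by ring) (mul_left_cancel₀ h2 ?_)
  simp only [circleSet, Set.mem_ofPred_eq, sqDist] at hP hQ h
  linear_combination hP + hQ - h

/-- From any point of a circle, a perfect distance is realized by some point of the
circle; it is realized by two distinct points iff it differs from `4r²`. -/
theorem perfect_dist_realized {F : Type*} [Field F] (hchar : ringChar F ≠ 2)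
    (M : F × F) (r : F) (hr : r ≠ 0) (P : F × F) (hP : P ∈ circleSet M r)
    (q : F) (hq : IsPerfectDist M r q) :
    (∃ Q ∈ circleSet M r, sqDist P Q = q) ∧
    ((∃ Q₁ ∈ circleSet M r, ∃ Q₂ ∈ circleSet M r, Q₁ ≠ Q₂ ∧
        sqDist P Q₁ = q ∧ sqDist P Q₂ = q) ↔ q ≠ 4 * r ^ 2) := by
  have h2 : (2 : F) ≠ 0 := Ring.two_ne_zero hchar
  obtain ⟨P₁, P₂, -, hP₁, hP₂, -, hne, -, -, -, -, -, rfl⟩ := hq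
  obtain ⟨a, b, hab, ha, hq⟩ := exists_rotation_of_mem_circleSet hr hP₁ hP₂ hne
  rw [hq]
  have hrot := rotation_mem_circleSet hP hab
  refine ⟨⟨_, hrot⟩, ?_, fun hq4 => ?_⟩
  · rintro ⟨Q₁, hQ₁, Q₂, hQ₂, hQ, hd₁, hd₂⟩ h4
    rw [h4] at hd₁ hd₂
    exact hQ ((eq_antipode_of_sqDist_eq h2 hr hP hQ₁ hd₁).trans
      (eq_antipode_of_sqDist_eq h2 hr hP hQ₂ hd₂).symm)
  · have hrot' := rotation_mem_circleSet (a := a) (b := -b) hP (by rwa [neg_sq])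
    refine ⟨_, hrot.1, _, hrot'.1, fun h => ?_, hrot.2, hrot'.2⟩
    obtain ⟨hx, hy⟩ := Prod.mk.inj h
    have hb : b = 0 := by
      refine mul_left_cancel₀ (mul_ne_zero h2 (pow_ne_zero 2 hr)) ?_
      simp only [circleSet, Set.mem_ofPred_eq] at hP
      linear_combination -2 * b * hP - (P.2 - M.2) * hx + (P.1 - M.1) * hy
    have hsq : a ^ 2 = 1 := by simpa [hb] using hab
    rcases mul_self_eq_one_iff.mp ((sq a).symm.trans hsq) with h1 | h1
    · exact ha h1
    · exact hq4 (by rw [h1]; ring)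
end

section
/- Let F be a field of prime characteristic p with p > 3, let M ∈ F × F, and let r ∈ F with r ≠ 0 such that r belongs to the prime subfield of F. Then the maximal cardinality of a subset S of the circle C(M,r)_F such that all pairwise squared distances between points of S are squares of elements of the prime subfield equals (p+1)/2 if −1 is not a square in the prime subfield, and equals (p−1)/2 if −1 is a square in the prime subfield; that is, every such subset has at most this many elements and some such subset attains this cardinality. -/
/-- The point with parameter `t` in the rational parametrization of the circle with center `M`
by stereographic projection from its point `Q`. -/
def stereographicPoint {F : Type*} [Field F] (M Q : F × F) (t : F) : F × F :=
  (M.1 + ((t ^ 2 - 1) * (Q.1 - M.1) - 2 * t * (Q.2 - M.2)) / (1 + t ^ 2),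
    M.2 + ((t ^ 2 - 1) * (Q.2 - M.2) + 2 * t * (Q.1 - M.1)) / (1 + t ^ 2))

section Parametrization

variable {F : Type*} [Field F] {M Q : F × F} {r t u : F}

lemma stereographicPoint_mem_circleSet (hQ : Q ∈ circleSet M r) (ht : 1 + t ^ 2 ≠ 0) :
    stereographicPoint M Q t ∈ circleSet M r := by
  simp only [circleSet, Set.mem_ofPred_eq, stereographicPoint, add_sub_cancel_left] at hQ ⊢
  rw [← hQ]
  field_simp
  ring

lemma sqDist_stereographicPoint (hQ : Q ∈ circleSet M r) (ht : 1 + t ^ 2 ≠ 0)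
    (hu : 1 + u ^ 2 ≠ 0) :
    sqDist (stereographicPoint M Q t) (stereographicPoint M Q u) * ((1 + t ^ 2) * (1 + u ^ 2)) =
      (2 * r * (t - u)) ^ 2 := by
  simp only [circleSet, Set.mem_ofPred_eq] at hQ
  rw [show (2 * r * (t - u)) ^ 2 = r ^ 2 * (2 * (t - u)) ^ 2 by ring, ← hQ]
  simp only [sqDist, stereographicPoint]
  field_simp
  ring

lemma sqDist_stereographicPoint_base (hQ : Q ∈ circleSet M r) (ht : 1 + t ^ 2 ≠ 0) :
    sqDist (stereographicPoint M Q t) Q * (1 + t ^ 2) = (2 * r) ^ 2 := by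
  simp only [circleSet, Set.mem_ofPred_eq] at hQ
  rw [show (2 * r) ^ 2 = r ^ 2 * 4 by ring, ← hQ]
  have h1 : (stereographicPoint M Q t).1 - Q.1 =
      (-2 * (Q.1 - M.1) - 2 * t * (Q.2 - M.2)) / (1 + t ^ 2) := by
    simp only [stereographicPoint]
    field_simp
    ring
  have h2 : (stereographicPoint M Q t).2 - Q.2 =
      (-2 * (Q.2 - M.2) + 2 * t * (Q.1 - M.1)) / (1 + t ^ 2) := by
    simp only [stereographicPoint]
    field_simp
    ring
  rw [sqDist, h1, h2]
  field_simp
  ring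

lemma exists_eq_stereographicPoint (h2 : (2 : F) ≠ 0) (hr : r ≠ 0) (hQ : Q ∈ circleSet M r)
    {P : F × F} (hP : P ∈ circleSet M r) (hPQ : P ≠ Q) :
    ∃ t, 1 + t ^ 2 ≠ 0 ∧ P = stereographicPoint M Q t := by
  obtain ⟨m, n⟩ := M
  obtain ⟨a, b⟩ := Q
  obtain ⟨x, y⟩ := P
  simp only [circleSet, Set.mem_ofPred_eq] at hP hQ
  obtain ⟨a, rfl⟩ : ∃ a', a = m + a' := ⟨a - m, by ring⟩
  obtain ⟨b, rfl⟩ : ∃ b', b = n + b' := ⟨b - n, by ring⟩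
  obtain ⟨x, rfl⟩ : ∃ x', x = m + x' := ⟨x - m, by ring⟩
  obtain ⟨y, rfl⟩ : ∃ y', y = n + y' := ⟨y - n, by ring⟩
  simp only [add_sub_cancel_left] at hP hQ
  have hr2 : r ^ 2 ≠ 0 := pow_ne_zero 2 hr
  set d := r ^ 2 - (a * x + b * y) with hd
  set c := a * y - b * x with hc
  have hcd : c ^ 2 = d * (2 * r ^ 2 - d) := by
    linear_combination (x ^ 2 + y ^ 2) * hQ + r ^ 2 * hP
  have hx : r ^ 2 * x = (r ^ 2 - d) * a - c * b := by
    linear_combination -x * hQ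
  have hy : r ^ 2 * y = (r ^ 2 - d) * b + c * a := by
    linear_combination -y * hQ
  have hd0 : d ≠ 0 := by
    intro h0
    have hc0 : c = 0 := by simpa [h0] using hcd
    rw [h0, hc0] at hx hy
    refine hPQ (Prod.ext ?_ ?_)
    · have : x = a := mul_left_cancel₀ hr2 (by linear_combination hx)
      simp [this]
    · have : y = b := mul_left_cancel₀ hr2 (by linear_combination hy)
      simp [this]
  have key : d * (1 + (c / d) ^ 2) = 2 * r ^ 2 := by
    field_simp
    linear_combination hcd
  have ht : 1 + (c / d) ^ 2 ≠ 0 := by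
    intro h0
    rw [h0, mul_zero] at key
    exact mul_ne_zero h2 hr2 key.symm
  have hc' : d * (c / d) = c := mul_div_cancel₀ c hd0
  refine ⟨c / d, ht, ?_⟩
  generalize c / d = t at *
  have h2r : 2 * r ^ 2 ≠ 0 := mul_ne_zero h2 hr2
  have e1 : x * (1 + t ^ 2) = (t ^ 2 - 1) * a - 2 * t * b := by
    apply mul_left_cancel₀ hr2
    linear_combination (1 + t ^ 2) * hx - a * key - b * (1 + t ^ 2) * hc'.symm - b * t * key
  have e2 : y * (1 + t ^ 2) = (t ^ 2 - 1) * b + 2 * t * a := by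
    apply mul_left_cancel₀ hr2
    linear_combination (1 + t ^ 2) * hy - b * key + a * (1 + t ^ 2) * hc'.symm + a * t * key
  simp only [stereographicPoint, add_sub_cancel_left, Prod.mk.injEq]
  exact ⟨by rw [← e1, mul_div_cancel_right₀ _ ht], by rw [← e2, mul_div_cancel_right₀ _ ht]⟩

end Parametrization

section Count

variable (K : Type*) [Field K] [Fintype K]

open Classical in
/-- The elements `t` for which `1 + t ^ 2` is a nonzero square. -/
noncomputable def squareParameters : Finset K :=
  Finset.univ.filter fun t => ∃ s : K, s ≠ 0 ∧ 1 + t ^ 2 = s ^ 2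

variable {K}

open Classical in
lemma two_mul_card_squareParameters (h2 : (2 : K) ≠ 0) :
    2 * (squareParameters K).card =
      (Finset.univ.filter fun m : K => m ≠ 0 ∧ m ^ 2 ≠ -1).card := by
  refine ((Finset.card_eq_sum_card_fiberwise (f := fun m : K => (m⁻¹ - m) / 2)
    (t := squareParameters K) ?mapsTo).trans ?sum).symm
  case sum =>
    rw [Finset.sum_const_nat (m := 2), mul_comm]
    intro t ht
    obtain ⟨s, hs, hst⟩ := (Finset.mem_filter.mp ht).2
    rw [Finset.card_eq_two]
    have hprod : (s - t) * (s + t) = 1 := by linear_combination -hst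
    have hprod' : (-s - t) * (-s + t) = 1 := by linear_combination -hst
    refine ⟨s - t, -s - t, ?_, ?_⟩
    · intro h
      exact mul_ne_zero h2 hs (by linear_combination h)
    · ext m
      simp only [Finset.mem_filter, Finset.mem_univ, true_and, Finset.mem_insert,
        Finset.mem_singleton]
      constructor
      · rintro ⟨⟨hm, -⟩, h⟩
        field_simp at h
        have : (m - (s - t)) * (m - (-s - t)) = 0 := by
          linear_combination -h + hst
        rcases mul_eq_zero.mp this with h | h
        · exact Or.inl (sub_eq_zero.mp h)
        · exact Or.inr (sub_eq_zero.mp h)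
      · have aux : ∀ s : K, s ≠ 0 → (s - t) * (s + t) = 1 →
            (s - t ≠ 0 ∧ (s - t) ^ 2 ≠ -1) ∧ ((s - t)⁻¹ - (s - t)) / 2 = t := by
          intro s hs hprod
          have hne : s - t ≠ 0 := left_ne_zero_of_mul_eq_one hprod
          refine ⟨⟨hne, fun h => ?_⟩, ?_⟩
          · exact mul_ne_zero h2 (mul_ne_zero hs hne) (by linear_combination h + hprod)
          · rw [inv_eq_of_mul_eq_one_right hprod]
            field_simp
            ring
        rintro (rfl | rfl)
        · exact aux s hs hprod
        · exact aux (-s) (neg_ne_zero.mpr hs) hprod'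
  case mapsTo =>
    intro m hm
    obtain ⟨hm, hm1⟩ := (Finset.mem_filter.mp hm).2
    refine Finset.mem_filter.mpr ⟨Finset.mem_univ _, (m⁻¹ + m) / 2, ?_, ?_⟩
    · intro h
      field_simp at h
      exact hm1 (by linear_combination h)
    · field_simp
      ring

open Classical in
lemma card_squareParameters_add_one [Decidable (∃ a : K, a ^ 2 = -1)] (h2 : (2 : K) ≠ 0) :
    (squareParameters K).card + 1 =
      if ∃ a : K, a ^ 2 = -1 then (Fintype.card K - 1) / 2 else (Fintype.card K + 1) / 2 := by
  have h := two_mul_card_squareParameters h2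
  have hneg : (Finset.univ.filter fun m : K => m ≠ 0 ∧ m ^ 2 ≠ -1) =
      Finset.univ \ insert 0 (Finset.univ.filter fun m : K => m ^ 2 = -1) := by
    ext m
    simp
  rw [hneg, Finset.card_univ_sdiff, Finset.card_insert_of_notMem (by simp)] at h
  have hle : (Finset.univ.filter fun m : K => m ^ 2 = -1).card + 1 ≤ Fintype.card K := by
    rw [← Finset.card_insert_of_notMem (a := (0 : K)) (by simp)]
    exact Finset.card_le_univ _
  split_ifs with hi
  · obtain ⟨i, hi⟩ := hi
    have hset : (Finset.univ.filter fun m : K => m ^ 2 = -1) = {i, -i} := by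
      ext m
      simp [← hi, sq_eq_sq_iff_eq_or_eq_neg]
    have hii : i ≠ -i := by
      intro h
      have hi0 : i ≠ 0 := by
        rintro rfl
        simp at hi
      exact mul_ne_zero h2 hi0 (by linear_combination h)
    rw [hset, Finset.card_pair hii] at h hle
    omega
  · have hset : (Finset.univ.filter fun m : K => m ^ 2 = -1) = ∅ := by
      simpa [Finset.filter_eq_empty_iff] using hi
    rw [hset, Finset.card_empty] at h hle
    omega

end Count

section PointSets

variable {F K : Type*} [Field F] [Field K] [Fintype K] (φ : K →+* F) {M : F × F} {r : K}

open Classical in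
lemma card_le_of_sqDist_eq_sq (h2 : (2 : K) ≠ 0) (hK : 4 < Fintype.card K) (hr : r ≠ 0)
    {S : Finset (F × F)} (hS : ↑S ⊆ circleSet M (φ r))
    (hsq : ∀ P ∈ S, ∀ Q ∈ S, ∃ a : K, sqDist P Q = φ a ^ 2) :
    S.card ≤ (squareParameters K).card + 1 := by
  have h2F : (2 : F) ≠ 0 := map_ofNat φ 2 ▸ (map_ne_zero φ).mpr h2
  have hrF : φ r ≠ 0 := (map_ne_zero φ).mpr hr
  obtain rfl | ⟨Q, hQS⟩ := S.eq_empty_or_nonempty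
  · simp
  have hQ : Q ∈ circleSet M (φ r) := hS hQS
  have hparam : ∀ P ∈ S.erase Q, ∃ t : F, ∃ s : K, s ≠ 0 ∧ 1 + t ^ 2 = φ s ^ 2 ∧
      P = stereographicPoint M Q t := by
    intro P hP
    obtain ⟨hPQ, hPS⟩ := Finset.mem_erase.mp hP
    obtain ⟨t, ht, rfl⟩ := exists_eq_stereographicPoint h2F hrF hQ (hS hPS) hPQ
    obtain ⟨a, ha⟩ := hsq _ hPS _ hQS
    have h := sqDist_stereographicPoint_base hQ ht
    rw [ha] at h
    have ha0 : φ a ≠ 0 := by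
      intro h0
      rw [h0] at h
      exact pow_ne_zero 2 (mul_ne_zero h2F hrF) (by rw [← h]; ring)
    refine ⟨t, 2 * r / a, div_ne_zero (mul_ne_zero h2 hr) ((map_ne_zero φ).mp ha0), ?_, rfl⟩
    rw [map_div₀, map_mul, map_ofNat, div_pow, eq_div_iff (pow_ne_zero 2 ha0), ← h]
    ring
  have hdiff : ∀ t u : F, ∀ s v : K, s ≠ 0 → v ≠ 0 → 1 + t ^ 2 = φ s ^ 2 →
      1 + u ^ 2 = φ v ^ 2 → stereographicPoint M Q t ∈ S → stereographicPoint M Q u ∈ S →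
      ∃ c : K, t = u + φ c := by
    intro t u s v hs hv hts huv htS huS
    have hs0 : φ s ≠ 0 := (map_ne_zero φ).mpr hs
    have hv0 : φ v ≠ 0 := (map_ne_zero φ).mpr hv
    obtain ⟨a, ha⟩ := hsq _ htS _ huS
    have h := sqDist_stereographicPoint (t := t) (u := u) hQ
      (by rw [hts]; exact pow_ne_zero 2 hs0) (by rw [huv]; exact pow_ne_zero 2 hv0)
    rw [ha, hts, huv, ← mul_pow, ← mul_pow, sq_eq_sq_iff_eq_or_eq_neg] at h
    have h2r : 2 * φ r ≠ 0 := mul_ne_zero h2F hrF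
    rcases h with h | h
    · refine ⟨a * (s * v) / (2 * r), ?_⟩
      simp only [map_div₀, map_mul, map_ofNat, h]
      field_simp
      ring
    · refine ⟨-(a * (s * v)) / (2 * r), ?_⟩
      simp only [map_div₀, map_mul, map_neg, map_ofNat, h]
      field_simp
      ring
  have hT : 2 ≤ (squareParameters K).card + 1 := by
    rw [card_squareParameters_add_one h2]
    split_ifs <;> omega
  rw [← Finset.card_erase_add_one hQS]
  by_cases hex : ∃ t : F, (∃ s : K, s ≠ 0 ∧ 1 + t ^ 2 = φ s ^ 2) ∧
      stereographicPoint M Q t ∈ S.erase Q ∧ ∀ k : K, φ k ≠ t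
  · obtain ⟨t, ⟨s, hs, hts⟩, htS, htK⟩ := hex
    have hsub : S.erase Q ⊆ {stereographicPoint M Q t} := by
      intro P hP
      obtain ⟨u, v, hv, huv, rfl⟩ := hparam P hP
      obtain ⟨c, rfl⟩ := hdiff u t v s hv hs huv hts (Finset.mem_of_mem_erase hP)
        (Finset.mem_of_mem_erase htS)
      rw [Finset.mem_singleton]
      by_cases hc : c = 0
      · simp [hc]
      · refine absurd ?_ (htK ((v ^ 2 - s ^ 2 - c ^ 2) / (2 * c)))
        have hcF : φ c ≠ 0 := (map_ne_zero φ).mpr hc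
        simp only [map_div₀, map_sub, map_pow, map_mul, map_ofNat]
        rw [div_eq_iff (mul_ne_zero h2F hcF)]
        linear_combination hts - huv
    have := Finset.card_le_card hsub
    rw [Finset.card_singleton] at this
    omega
  · push Not at hex
    have hsub : S.erase Q ⊆
        (squareParameters K).image fun t => stereographicPoint M Q (φ t) := by
      intro P hP
      obtain ⟨t, s, hs, hts, rfl⟩ := hparam P hP
      obtain ⟨k, rfl⟩ := hex t ⟨s, hs, hts⟩ hP
      refine Finset.mem_image_of_mem _ (Finset.mem_filter.mpr ⟨Finset.mem_univ _, s, hs, ?_⟩)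
      exact φ.injective (by simpa using hts)
    exact Nat.add_le_add_right ((Finset.card_le_card hsub).trans Finset.card_image_le) 1

lemma sqDist_comm {F : Type*} [Field F] (P Q : F × F) : sqDist P Q = sqDist Q P := by
  simp only [sqDist]
  ring

open Classical in
lemma exists_card_eq_of_sqDist_eq_sq (h2 : (2 : K) ≠ 0) (hr : r ≠ 0) :
    ∃ S : Finset (F × F), ↑S ⊆ circleSet M (φ r) ∧
      (∀ P ∈ S, ∀ Q ∈ S, ∃ a : K, sqDist P Q = φ a ^ 2) ∧
      S.card = (squareParameters K).card + 1 := by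
  have h2F : (2 : F) ≠ 0 := map_ofNat φ 2 ▸ (map_ne_zero φ).mpr h2
  have hrF : φ r ≠ 0 := (map_ne_zero φ).mpr hr
  set Q : F × F := (M.1 + φ r, M.2) with hQdef
  have hQ : Q ∈ circleSet M (φ r) := by simp [circleSet, hQdef]
  have hne : ∀ t ∈ squareParameters K, ∃ s : K, φ s ≠ 0 ∧ 1 + φ t ^ 2 = φ s ^ 2 := by
    intro t ht
    obtain ⟨s, hs, hts⟩ := (Finset.mem_filter.mp ht).2
    exact ⟨s, (map_ne_zero φ).mpr hs, by simpa using congrArg φ hts⟩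
  have hne' : ∀ t ∈ squareParameters K, 1 + φ t ^ 2 ≠ 0 := by
    intro t ht
    obtain ⟨s, hs, hts⟩ := hne t ht
    exact hts ▸ pow_ne_zero 2 hs
  have hbase : ∀ t ∈ squareParameters K, ∃ a : K,
      sqDist (stereographicPoint M Q (φ t)) Q = φ a ^ 2 := by
    intro t ht
    obtain ⟨s, hs, hts⟩ := hne t ht
    refine ⟨2 * r / s, mul_right_cancel₀ (hne' t ht) ?_⟩
    rw [sqDist_stereographicPoint_base hQ (hne' t ht), hts, map_div₀, map_mul, map_ofNat]
    field_simp
  refine ⟨insert Q ((squareParameters K).image fun t => stereographicPoint M Q (φ t)),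
    ?_, ?_, ?_⟩
  · intro P hP
    simp only [Finset.coe_insert, Finset.coe_image, Set.mem_insert_iff, Set.mem_image,
      Finset.mem_coe] at hP
    rcases hP with rfl | ⟨t, ht, rfl⟩
    · exact hQ
    · exact stereographicPoint_mem_circleSet hQ (hne' t ht)
  · intro P hP P' hP'
    simp only [Finset.mem_insert, Finset.mem_image] at hP hP'
    rcases hP with rfl | ⟨t, ht, rfl⟩ <;> rcases hP' with rfl | ⟨u, hu, rfl⟩
    · exact ⟨0, by simp [sqDist]⟩
    · rw [sqDist_comm]
      exact hbase u hu
    · exact hbase t ht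
    · obtain ⟨s, hs, hts⟩ := hne t ht
      obtain ⟨v, hv, huv⟩ := hne u hu
      refine ⟨2 * r * (t - u) / (s * v),
        mul_right_cancel₀ (mul_ne_zero (hne' t ht) (hne' u hu)) ?_⟩
      rw [sqDist_stereographicPoint hQ (hne' t ht) (hne' u hu), hts, huv]
      simp only [map_div₀, map_mul, map_sub, map_ofNat]
      field_simp
  · rw [Finset.card_insert_of_notMem, Finset.card_image_of_injOn]
    · intro t ht u hu htu
      have h := sqDist_stereographicPoint hQ (hne' t ht) (hne' u hu)
      simp only at htu
      rw [htu] at h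
      have h0 : (2 * φ r * (φ t - φ u)) ^ 2 = 0 := by
        rw [← h]
        simp [sqDist]
      have h1 := (mul_eq_zero.mp (pow_eq_zero_iff two_ne_zero |>.mp h0)).resolve_left
        (mul_ne_zero h2F hrF)
      exact φ.injective (sub_eq_zero.mp h1)
    · intro hmem
      obtain ⟨t, ht, htQ⟩ := Finset.mem_image.mp hmem
      have h := sqDist_stereographicPoint_base hQ (hne' t ht)
      rw [htQ] at h
      refine pow_ne_zero 2 (mul_ne_zero h2F hrF) ?_
      rw [← h]
      simp [sqDist]

end PointSets

open Classical in
/-- Over a field of prime characteristic `p > 3` and for a radius lying in the prime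
subfield, the maximal cardinality of a rational point set on a circle is `(p+1)/2`
if `-1` is not a square in the prime subfield and `(p-1)/2` otherwise. -/
theorem c_maximal_card {F : Type*} [Field F] (p : ℕ) (hp : p.Prime) (hchar : CharP F p)
    (hp3 : 3 < p) (M : F × F) (r : F) (hr : r ≠ 0) (hrP : r ∈ (⊥ : Subfield F)) :
    IsGreatest
      {n : ℕ | ∃ S : Finset (F × F), ↑S ⊆ circleSet M r ∧
        (∀ P ∈ S, ∀ Q ∈ S, ∃ a ∈ (⊥ : Subfield F), sqDist P Q = a ^ 2) ∧ S.card = n}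
      (if ∃ a ∈ (⊥ : Subfield F), a ^ 2 = (-1 : F) then (p - 1) / 2 else (p + 1) / 2) := by
  have : Fact p.Prime := ⟨hp⟩
  let φ : ZMod p →+* F := ZMod.castHom dvd_rfl F
  have hbot : (⊥ : Subfield F) = φ.fieldRange :=
    (ZMod.fieldRange_castHom_eq_bot p).symm
  have hp4 : 4 < p := lt_of_le_of_ne hp3 (by rintro rfl; exact absurd hp (by decide))
  have h2 : (2 : ZMod p) ≠ 0 := by
    intro h
    have := (ZMod.natCast_eq_zero_iff 2 p).mp (by exact_mod_cast h)
    exact absurd (Nat.le_of_dvd two_pos this) (by omega)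
  have hneg : (∃ a : F, a ∈ φ.fieldRange ∧ a ^ 2 = -1) ↔ ∃ a : ZMod p, a ^ 2 = -1 := by
    constructor
    · rintro ⟨_, ⟨a, rfl⟩, ha⟩
      exact ⟨a, φ.injective (by simpa using ha)⟩
    · rintro ⟨a, ha⟩
      exact ⟨φ a, ⟨a, rfl⟩, by rw [← map_pow, ha, map_neg, map_one]⟩
  have hcard := card_squareParameters_add_one h2
  rw [ZMod.card] at hcard
  rw [hbot] at hrP ⊢
  have hval : (if ∃ a ∈ φ.fieldRange, a ^ 2 = (-1 : F) then (p - 1) / 2 else (p + 1) / 2) =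
      (squareParameters (ZMod p)).card + 1 := by
    rw [hcard]
    exact if_congr hneg rfl rfl
  rw [hval]
  obtain ⟨k, rfl⟩ := hrP
  have hk : k ≠ 0 := (map_ne_zero φ).mp hr
  constructor
  · obtain ⟨S, hS, hsq, hSc⟩ := exists_card_eq_of_sqDist_eq_sq (M := M) φ h2 hk
    refine ⟨S, hS, fun P hP Q hQ => ?_, hSc⟩
    obtain ⟨a, ha⟩ := hsq P hP Q hQ
    exact ⟨φ a, ⟨a, rfl⟩, ha⟩
  · rintro _ ⟨S, hS, hsq, rfl⟩
    refine card_le_of_sqDist_eq_sq φ h2 (by rwa [ZMod.card p]) hk hS fun P hP Q hQ => ?_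
    obtain ⟨_, ⟨a, rfl⟩, ha⟩ := hsq P hP Q hQ
    exact ⟨a, ha⟩
end

section
/- Let x, y be coprime integers and suppose the norm x² + y² equals k² for some natural number k > 1. Then for every natural number n ≥ 1, the Gaussian integer (x + y·i)^n is not a natural number; that is, there is no m ∈ ℕ with (x + y·i)^n = m in ℤ[i]. -/
/-- A Gaussian integer with coprime coordinates that divides its conjugate divides `2`. -/
theorem GaussianInt.dvd_two_of_dvd_star {z : GaussianInt} (hz : IsCoprime z.re z.im)
    (h : z ∣ star z) : z ∣ 2 := by
  obtain ⟨a, b, hab⟩ := hz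
  have hre : z ∣ 2 * (z.re : GaussianInt) := by
    have : 2 * (z.re : GaussianInt) = z + star z := by
      ext <;> simp [two_mul]
    exact this ▸ dvd_add dvd_rfl h
  have him : z ∣ 2 * (z.im : GaussianInt) := by
    have : 2 * (z.im : GaussianInt) = (star z - z) * ⟨0, 1⟩ := by
      ext <;> simp [two_mul]
    exact this ▸ (dvd_sub h dvd_rfl).mul_right _
  have hab' : (a : GaussianInt) * z.re + b * z.im = 1 := by exact_mod_cast hab
  have : (2 : GaussianInt) = a * (2 * z.re) + b * (2 * z.im) := by
    linear_combination -2 * hab'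
  exact this ▸ dvd_add (hre.mul_left _) (him.mul_left _)

/-- A sum of squares of coprime integers is not divisible by `4`. -/
theorem IsCoprime.not_four_dvd_sq_add_sq {x y : ℤ} (h : IsCoprime x y) :
    ¬(4 : ℤ) ∣ x ^ 2 + y ^ 2 := by
  intro h4
  rcases Int.even_or_odd' x with ⟨a, rfl | rfl⟩ <;> rcases Int.even_or_odd' y with ⟨b, rfl | rfl⟩
  · have := h.isUnit_of_dvd' (dvd_mul_right 2 a) (dvd_mul_right 2 b)
    norm_num [Int.isUnit_iff] at this
  all_goals ring_nf at h4; omega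

/-- If `x, y` are coprime integers with `x² + y²` a square `k² > 1`, then no positive
power of the Gaussian integer `x + y·i` is a natural number. -/
theorem gaussian_power_not_natural (x y : ℤ) (hxy : IsCoprime x y) (k : ℕ) (hk : 1 < k)
    (hnorm : x ^ 2 + y ^ 2 = (k : ℤ) ^ 2) :
    ∀ n : ℕ, 1 ≤ n → ¬∃ m : ℕ, (⟨x, y⟩ : GaussianInt) ^ n = (m : GaussianInt) := by
  rintro n hn ⟨m, hm⟩
  have hstar : (⟨x, y⟩ : GaussianInt) ∣ star ⟨x, y⟩ := by
    rw [← IsIntegrallyClosed.pow_dvd_pow_iff (Nat.one_le_iff_ne_zero.mp hn), ← star_pow, hm,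
      star_natCast]
  obtain ⟨w, hw⟩ := GaussianInt.dvd_two_of_dvd_star (z := ⟨x, y⟩) hxy hstar
  have hdvd : (k : ℤ) ^ 2 ∣ 2 ^ 2 := by
    refine ⟨w.norm, ?_⟩
    have := congrArg Zsqrtd.norm hw
    rw [Zsqrtd.norm_mul] at this
    simp only [Zsqrtd.norm_def, Zsqrtd.re_ofNat, Zsqrtd.im_ofNat] at this ⊢
    rw [← hnorm]
    push_cast at this
    linear_combination this
  have hk2 : k ∣ 2 := by
    exact_mod_cast (Int.pow_dvd_pow_iff two_ne_zero).mp hdvd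
  have : k = 2 := le_antisymm (Nat.le_of_dvd two_pos hk2) hk
  subst this
  exact hxy.not_four_dvd_sq_add_sq (by rw [hnorm]; norm_num)
end

section
/- Let a, b, r ∈ ℚ with a ≠ 0, b ≠ 0 and a² + b² = r². Then for every natural number n ≥ 1, the complex number ((a + b·I)/r)^n is not equal to 1; in other words, the point (a,b) on the circle C((0,0), r)_ℚ generates an infinite subgroup under the rotation product, since the rotation product corresponds to complex multiplication of points rescaled by 1/r. -/
/-- A rational number whose image in `ℂ` is an algebraic integer is an integer. -/
theorem exists_int_cast_eq_of_isIntegral_ratCast {q : ℚ} (h : IsIntegral ℤ (q : ℂ)) :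
    ∃ m : ℤ, (m : ℚ) = q := by
  have h' : IsIntegral ℤ (algebraMap ℚ ℂ q) := by simpa using h
  exact IsIntegrallyClosed.isIntegral_iff.mp
    ((isIntegral_algebraMap_iff (algebraMap ℚ ℂ).injective).mp h')

/-- A decomposition of `4` as a sum of two integer squares is trivial. -/
theorem Int.mul_eq_zero_of_sq_add_sq_eq_four {m k : ℤ} (h : m ^ 2 + k ^ 2 = 4) : m * k = 0 := by
  have hm : m ≤ 2 := by nlinarith
  have hm' : -2 ≤ m := by nlinarith
  have hk : k ≤ 2 := by nlinarith
  have hk' : -2 ≤ k := by nlinarith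
  interval_cases m <;> interval_cases k <;> simp_all

open Complex in
/-- A root of unity with rational real and imaginary parts lies on a coordinate axis. -/
theorem mul_eq_zero_of_ratCast_add_mul_I_pow_eq_one {c d : ℚ} (hcd : c ^ 2 + d ^ 2 = 1) {n : ℕ}
    (hn : 0 < n) (h : ((c : ℂ) + d * I) ^ n = 1) : c * d = 0 := by
  have hcd' : (c : ℂ) ^ 2 + (d : ℂ) ^ 2 = 1 := mod_cast hcd
  have hI : IsIntegral ℤ I := .of_pow two_pos (by simpa using isIntegral_one.neg)
  have hz : IsIntegral ℤ ((c : ℂ) + d * I) := .of_pow hn (h ▸ isIntegral_one)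
  have hw : IsIntegral ℤ ((c : ℂ) - d * I) := by
    refine .of_pow hn ?_
    have hzw : ((c : ℂ) + d * I) * (c - d * I) = 1 := by
      linear_combination hcd' - (d : ℂ) ^ 2 * I_sq
    have := congrArg (· ^ n) hzw
    simp only [mul_pow, h, one_mul, one_pow] at this
    exact this ▸ isIntegral_one
  obtain ⟨m, hm⟩ := exists_int_cast_eq_of_isIntegral_ratCast (q := 2 * c) <| by
    have : ((2 * c : ℚ) : ℂ) = (c + d * I) + (c - d * I) := by
      push_cast
      ring
    exact this ▸ hz.add hw
  obtain ⟨k, hk⟩ := exists_int_cast_eq_of_isIntegral_ratCast (q := 2 * d) <| by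
    have : ((2 * d : ℚ) : ℂ) = I * ((c - d * I) - (c + d * I)) := by
      push_cast
      linear_combination 2 * (d : ℂ) * I_sq
    exact this ▸ hI.mul (hw.sub hz)
  have hmk : m ^ 2 + k ^ 2 = 4 := by
    have : (m : ℚ) ^ 2 + (k : ℚ) ^ 2 = 4 := by
      rw [hm, hk]
      linear_combination 4 * hcd
    exact_mod_cast this
  have hmul : (m : ℚ) * k = 0 := mod_cast Int.mul_eq_zero_of_sq_add_sq_eq_four hmk
  rw [hm, hk] at hmul
  linear_combination hmul / 4

open Complex in
/-- A point `(a, b)` of the circle of radius `r` over `ℚ` with both coordinates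
nonzero is acyclic: no positive power of `(a + b·I)/r` equals `1`, i.e. the point
generates an infinite subgroup under the rotation product. -/
theorem circle_point_acyclic (a b r : ℚ) (ha : a ≠ 0) (hb : b ≠ 0)
    (habr : a ^ 2 + b ^ 2 = r ^ 2) :
    ∀ n : ℕ, 1 ≤ n → (((a : ℂ) + (b : ℂ) * I) / (r : ℂ)) ^ n ≠ 1 := by
  intro n hn h
  have hr : r ≠ 0 := by
    rintro rfl
    have : 0 < a ^ 2 := by positivity
    nlinarith [sq_nonneg b]
  have hcd : (a / r) ^ 2 + (b / r) ^ 2 = 1 := by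
    field_simp
    exact habr
  have hmul : a / r * (b / r) = 0 := by
    refine mul_eq_zero_of_ratCast_add_mul_I_pow_eq_one hcd hn ?_
    rw [← h]
    push_cast
    ring
  simp_all
end
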